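/- Complementing a GFG co-Büchi automaton into a GFG Rabin automaton involves an exponential state blow-up: there exists a constant c > 0 such that for infinitely many n ∈ ℕ there is a GFG co-Büchi automaton C with at most n states, over some finite alphabet Σ, such that every GFG Rabin automaton recognizing the complement language Σ^ω \ L(C) has at least 2^{c·n} states. -/

import Mathlib

namespace GFG

/-- The structure of a nondeterministic automaton on infinite words:
alphabet `A`, states `Q`, initial states and transition function.
The acceptance condition is kept separate, as a predicate on the set
of states visited infinitely often. -/
structure Auto (A Q : Type) where
  init : Set Q
  next : Q → A → Set Q

variable {A Q Mem : Type}

/-- `r` is a run of the automaton `M` on the infinite word `w`. -/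
def Auto.IsRun (M : Auto A Q) (w : ℕ → A) (r : ℕ → Q) : Prop :=
  r 0 ∈ M.init ∧ ∀ i, r (i + 1) ∈ M.next (r i) (w i)

/-- The set of states occurring infinitely often in `r`. -/
def InfOcc (r : ℕ → Q) : Set Q := {q | ∀ n, ∃ m, n ≤ m ∧ r m = q}

/-- The language of `M` with acceptance condition `acc` (a predicate on `inf(r)`). -/
def Auto.Lang (M : Auto A Q) (acc : Set Q → Prop) : Set (ℕ → A) :=
  {w | ∃ r, M.IsRun w r ∧ acc (InfOcc r)}

/-- `M` is deterministic: one initial state and at most one successor per state/letter. -/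
def Auto.IsDet (M : Auto A Q) : Prop :=
  (∃ q0, M.init = {q0}) ∧ ∀ q a, (M.next q a).Subsingleton

/-- `A^q`: the automaton `M` with set of initial states `{q}`. -/
def Auto.withInit (M : Auto A Q) (q : Q) : Auto A Q := ⟨{q}, M.next⟩

/-- Büchi condition: `inf(r) ∩ α ≠ ∅`. -/
def BuchiAcc (α : Set Q) (S : Set Q) : Prop := (S ∩ α).Nonempty

/-- co-Büchi condition: `inf(r) ∩ α = ∅`. -/
def CoBuchiAcc (α : Set Q) (S : Set Q) : Prop := S ∩ α = ∅

/-- Rabin condition with bad sets `E i` and good sets `F i`. -/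
def RabinAcc {ι : Type} (E F : ι → Set Q) (S : Set Q) : Prop :=
  ∃ i, S ∩ E i = ∅ ∧ (S ∩ F i).Nonempty

/-- Streett condition with pairs `(E i, F i)`. -/
def StreettAcc {ι : Type} (E F : ι → Set Q) (S : Set Q) : Prop :=
  ∀ i, S ∩ E i = ∅ ∨ (S ∩ F i).Nonempty

/-- Parity condition: the minimal priority seen infinitely often is even. -/
def ParityAcc (c : Q → ℕ) (S : Set Q) : Prop := Even (sInf (c '' S))

/-- The prefix of length `n` of the infinite word `w`, as a list. -/
def prefixWord (w : ℕ → A) (n : ℕ) : List A := (List.range n).map w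

/-- The run induced by a strategy `g : A* → Q` on the word `w`:
`g(ε), g(a₁), g(a₁a₂), …`. -/
def StrategyRun (g : List A → Q) (w : ℕ → A) : ℕ → Q := fun n => g (prefixWord w n)

/-- `g` witnesses GFGness of `M` (with acceptance `acc`): for every word `w` the
induced sequence is a run of `M` on `w`, accepting whenever `w ∈ L(M)`. -/
def IsGFGStrategy (M : Auto A Q) (acc : Set Q → Prop) (g : List A → Q) : Prop :=
  ∀ w : ℕ → A, M.IsRun w (StrategyRun g w) ∧
    (w ∈ M.Lang acc → acc (InfOcc (StrategyRun g w)))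

/-- `M` is good for games. -/
def IsGFG (M : Auto A Q) (acc : Set Q → Prop) : Prop :=
  ∃ g : List A → Q, IsGFGStrategy M acc g

/-- `M` is unambiguous: every word of the language has exactly one accepting run. -/
def Unambiguous (M : Auto A Q) (acc : Set Q → Prop) : Prop :=
  ∀ w ∈ M.Lang acc, ∃! r : ℕ → Q, M.IsRun w r ∧ acc (InfOcc r)

/-- `M` is determinizable by pruning. -/
def DetByP (M : Auto A Q) (acc : Set Q → Prop) : Prop :=
  ∃ q0 ∈ M.init, ∃ next' : Q → A → Set Q,
    (∀ q a, next' q a ⊆ M.next q a ∧ (next' q a).Subsingleton) ∧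
    (⟨{q0}, next'⟩ : Auto A Q).Lang acc = M.Lang acc

/-- A finite-state strategy (transducer): memories `Mem`, initial memory `m0`,
memory update function `upd` and output function `out`. -/
structure Transducer (A Q Mem : Type) where
  m0 : Mem
  upd : Mem → A → Mem
  out : Mem → Q

namespace Transducer

variable (T : Transducer A Q Mem)

/-- The memory reached from `m` after reading the finite word `u`. -/
def run (m : Mem) (u : List A) : Mem := u.foldl T.upd m

/-- The strategy generated by the transducer: `u ↦ τ(ρ(m₀, u))`. -/
def strategy : List A → Q := fun u => T.out (T.run T.m0 u)

/-- The deterministic automaton `A_g`, with initial memory replaced by `m`. -/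
def autoFrom (m : Mem) : Auto A Mem := ⟨{m}, fun m' a => {T.upd m' a}⟩

/-- The deterministic automaton `A_g` itself. -/
def auto : Auto A Mem := T.autoFrom T.m0

/-- The acceptance condition `α_g` of `A_g`, obtained from `acc` by replacing each
set `F ⊆ Q` appearing in it by `{m | τ(m) ∈ F}`. -/
def accG (acc : Set Q → Prop) : Set Mem → Prop := fun S => acc (T.out '' S)

/-- `m` is reachable in `A_g` from the initial memory. -/
def Reachable (m : Mem) : Prop := ∃ u : List A, T.run T.m0 u = m

/-- The set of memories visited along the path of `A_g` that starts at `m` and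
reads the finite word `u` (both endpoints included). -/
def pathStates (m : Mem) (u : List A) : Set Mem :=
  {m' | ∃ v : List A, v <+: u ∧ T.run m v = m'}

/-- `P_{src → dst}`: the (words inducing the) finite paths of `A_g` from `src` to `dst`. -/
def PathSet (src dst : Mem) : Set (List A) :=
  {u : List A | u ≠ [] ∧ T.run src u = dst}

/-- Every combination of paths from `P_{src → dst}` satisfies `α_g`. -/
def AllCombosAcc (acc : Set Q → Prop) (src dst : Mem) : Prop :=
  ∀ S : Set (List A), S.Nonempty → S ⊆ T.PathSet src dst →
    T.accG acc (⋃ u ∈ S, T.pathStates src u)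

/-- `P_{src → dst}` is empty, or every combination of its paths satisfies `α_g`. -/
def GoodPathSet (acc : Set Q → Prop) (src dst : Mem) : Prop :=
  T.PathSet src dst = ∅ ∨ T.AllCombosAcc acc src dst

/-- `m` is replaceable by `m'`: the set `P_{m' → m}` of paths of `A_g` from `m'`
to `m` is empty, or every combination of its paths satisfies `α_g`. -/
def Replaceable (acc : Set Q → Prop) (m m' : Mem) : Prop :=
  T.GoodPathSet acc m' m

/-- The transition `(q, a, q')` is used by the strategy. -/
def Uses (q : Q) (a : A) (q' : Q) : Prop :=
  ∃ u : List A, T.strategy u = q ∧ T.strategy (u ++ [a]) = q'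

/-- The nonempty word `u` induces a cycle of `A_g` through the memory `m`. -/
def CycleThrough (m : Mem) (u : List A) : Prop := u ≠ [] ∧ T.run m u = m

/-- The cycle of `A_g` through `m` induced by `u` is accepting. -/
def AccCycle (acc : Set Q → Prop) (m : Mem) (u : List A) : Prop :=
  T.CycleThrough m u ∧ T.accG acc (T.pathStates m u)

/-- The cycle of `A_g` through `m` induced by `u` is rejecting. -/
def RejCycle (acc : Set Q → Prop) (m : Mem) (u : List A) : Prop :=
  T.CycleThrough m u ∧ ¬ T.accG acc (T.pathStates m u)

/-- The cycle of `A_g` through `m` induced by `u` is `q`-exclusive accepting: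
it is accepting, but its set of memories minus the memories of `q` is not. -/
def ExclAccCycle (acc : Set Q → Prop) (q : Q) (m : Mem) (u : List A) : Prop :=
  T.CycleThrough m u ∧ T.accG acc (T.pathStates m u) ∧
    ¬ T.accG acc (T.pathStates m u \ {m' : Mem | T.out m' = q})

end Transducer

/-- `M` is weakly tight with respect to `T`: every transition of `M` is used. -/
def WeaklyTightWrt (M : Auto A Q) (T : Transducer A Q Mem) : Prop :=
  ∀ q a q', q' ∈ M.next q a → T.Uses q a q'

/-- `M` is tight with respect to `T`: every transition of `M` is used, and no memory
is replaceable by a different memory of the same state. -/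
def TightWrt (M : Auto A Q) (acc : Set Q → Prop) (T : Transducer A Q Mem) : Prop :=
  WeaklyTightWrt M T ∧
  ∀ m m' : Mem, m ≠ m' → T.out m = T.out m' → ¬ T.Replaceable acc m m'

/-- `M` is tight: tight with respect to some finite-state strategy witnessing its GFGness. -/
def Tight (M : Auto A Q) (acc : Set Q → Prop) : Prop :=
  ∃ (Mem : Type) (_ : Fintype Mem) (T : Transducer A Q Mem),
    IsGFGStrategy M acc T.strategy ∧ TightWrt M acc T

/-- `M` is weakly tight: weakly tight with respect to some finite-state strategy
witnessing its GFGness. -/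
def WeaklyTight (M : Auto A Q) (acc : Set Q → Prop) : Prop :=
  ∃ (Mem : Type) (_ : Fintype Mem) (T : Transducer A Q Mem),
    IsGFGStrategy M acc T.strategy ∧ WeaklyTightWrt M T

/-- A Rabin automaton `M` (with pairs `(E i, F i)`) is strongly tight with respect to `T`:
tight, and every state appearing in some good set has a `q`-exclusive accepting cycle
in `A_g`. -/
def StronglyTightWrt {ι : Type} (M : Auto A Q) (E F : ι → Set Q)
    (T : Transducer A Q Mem) : Prop :=
  TightWrt M (RabinAcc E F) T ∧
  ∀ q : Q, (∃ i, q ∈ F i) →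
    ∃ (m : Mem) (u : List A), T.ExclAccCycle (RabinAcc E F) q m u

/-- A Rabin automaton is strongly tight: strongly tight with respect to some finite-state
strategy witnessing its GFGness. -/
def StronglyTight {ι : Type} (M : Auto A Q) (E F : ι → Set Q) : Prop :=
  ∃ (Mem : Type) (_ : Fintype Mem) (T : Transducer A Q Mem),
    IsGFGStrategy M (RabinAcc E F) T.strategy ∧ StronglyTightWrt M E F T

/-- One-step reachability in the transition graph of `M`. -/
def Auto.Step (M : Auto A Q) (q q' : Q) : Prop := ∃ a, q' ∈ M.next q a

/-- Reachability in the transition graph of `M`. -/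
def Auto.Reach (M : Auto A Q) : Q → Q → Prop := Relation.ReflTransGen M.Step

/-- The Büchi automaton `(M, α)` is weak: each strongly connected component is either
contained in `α` or disjoint from `α`. -/
def Auto.IsWeak (M : Auto A Q) (α : Set Q) : Prop :=
  ∀ q q', M.Reach q q' → M.Reach q' q → (q ∈ α ↔ q' ∈ α)

section Game

variable {V B : Type}

/-- Opponent machine: every play following it is losing for the player. -/
def IsMach (Lose : Set V → Prop) (E : V × B → Finset V) {M : Type} (l : M → V × B)
    (step : M → V → M) : Prop :=
  (∀ m, ∀ c ∈ E (l m), (l (step m c)).1 = c) ∧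
  ∀ (x : ℕ → M) (c : ℕ → V),
    (∀ i, c i ∈ E (l (x i)) ∧ x (i + 1) = step (x i) (c i)) → Lose (InfOcc c)

def WinF (Lose : Set V → Prop) (f : V × B → V) (s : V × B) : Prop :=
  ∀ b : ℕ → V × B, b 0 = s → (∀ i, (b (i + 1)).1 = f (b i)) →
    ¬ Lose (InfOcc (fun i => f (b i)))

lemma infOcc_nth (c : ℕ → V) (p : ℕ → Prop) (hp : (Set.ofPred p).Infinite) :
    InfOcc (fun k => c (Nat.nth p k)) = {v | ∀ n, ∃ m, n ≤ m ∧ p m ∧ c m = v} := by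
  classical
  ext v
  constructor
  · intro h n
    obtain ⟨k, hk, e⟩ := h n
    exact ⟨Nat.nth p k, hk.trans ((Nat.nth_strictMono hp).le_apply),
      Nat.nth_mem_of_infinite hp k, e⟩
  · intro h n
    obtain ⟨k, hk, hpk, e⟩ := h (Nat.nth p n)
    refine ⟨Nat.count p k, ?_, ?_⟩
    · rw [← Nat.nth_le_nth hp, Nat.nth_count hpk]; exact hk
    · simp only [Nat.nth_count hpk]; exact e

lemma mach_sub {Lose : Set V → Prop} {E : V × B → Finset V} {M : Type} {l : M → V × B}
    {step : M → V → M} (h : IsMach Lose E l step) (x : ℕ → M) (c : ℕ → V) (p : ℕ → Prop)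
    (hp : (Set.ofPred p).Infinite)
    (h1 : ∀ i, p i → c i ∈ E (l (x i)) ∧ x (i + 1) = step (x i) (c i))
    (h2 : ∀ i, ¬ p i → x (i + 1) = x i) :
    Lose {v | ∀ n, ∃ m, n ≤ m ∧ p m ∧ c m = v} := by
  rw [← infOcc_nth c p hp]
  refine h.2 (fun k => x (Nat.nth p k)) _ fun k => ?_
  have hk := h1 _ (Nat.nth_mem_of_infinite hp k)
  refine ⟨hk.1, ?_⟩
  rw [← hk.2]
  have hlt : Nat.nth p k < Nat.nth p (k + 1) := (Nat.nth_strictMono hp) (Nat.lt_succ_self k)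
  have : ∀ d, Nat.nth p k + 1 + d ≤ Nat.nth p (k + 1) →
      x (Nat.nth p k + 1 + d) = x (Nat.nth p k + 1) := by
    intro d
    induction d with
    | zero => intro _; rfl
    | succ d ih =>
      intro hd
      rw [← ih (by omega), ← add_assoc]
      apply h2
      intro hpd
      have := Nat.le_nth_of_lt_nth_succ (p := p) (k := k) (by omega) hpd
      omega
  have := this (Nat.nth p (k + 1) - (Nat.nth p k + 1)) (by omega)
  rwa [Nat.add_sub_cancel' (by omega)] at this

open Classical in
lemma mach_combine {Lose : Set V → Prop}
    (hU : ∀ S T, Lose S → Lose T → Lose (S ∪ T))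
    {E E1 E2 : V × B → Finset V} {M1 M2 : Type} {l1 : M1 → V × B} {l2 : M2 → V × B}
    {s1 : M1 → V → M1} {s2 : M2 → V → M2}
    (h1 : IsMach Lose E1 l1 s1) (h2 : IsMach Lose E2 l2 s2) (p : V × B)
    (e1 : ∀ q, q ≠ p → E q = E1 q) (e2 : ∀ q, q ≠ p → E q = E2 q)
    (ep : ∀ c ∈ E p, c ∈ E1 p ∨ c ∈ E2 p) (m2 : M2) (hm2 : l2 m2 = p) :
    ∃ (M : Type) (l : M → V × B) (step : M → V → M), IsMach Lose E l step ∧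
      ∀ m1, ∃ m, l m = l1 m1 := by
  let M := {t : M1 × M2 × Prop // (t.2.2 → l2 t.2.1 = p) ∧ (¬ t.2.2 → l1 t.1 = p)}
  let l : M → V × B := fun t => if t.1.2.2 then l1 t.1.1 else l2 t.1.2.1
  let use1 : M → V → Prop := fun t c => if l t = p then c ∈ E1 p else t.1.2.2
  have key : ∀ t c, (use1 t c → l2 t.1.2.1 = p) ∧ (¬ use1 t c → l1 t.1.1 = p) := by
    rintro ⟨⟨a, b, q⟩, ha, hb⟩ c
    simp only [use1, l] at *
    by_cases q <;> simp_all
  let step : M → V → M := fun t c =>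
    if h : use1 t c then ⟨(s1 t.1.1 c, t.1.2.1, True), by simpa using (key t c).1 h⟩
    else ⟨(t.1.1, s2 t.1.2.1 c, False), by simpa using (key t c).2 h⟩
  have act1 : ∀ t c, c ∈ E (l t) → use1 t c → c ∈ E1 (l1 t.1.1) := by
    rintro ⟨⟨a, b, q⟩, ha, hb⟩ c hc hu
    simp only [use1, l] at *
    by_cases q
    · simp_all
      by_cases hh : l1 a = p <;> simp_all
    · simp_all
  have act2 : ∀ t c, c ∈ E (l t) → ¬ use1 t c → c ∈ E2 (l2 t.1.2.1) := by
    rintro ⟨⟨a, b, q⟩, ha, hb⟩ c hc hu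
    simp only [use1, l] at *
    by_cases q
    · simp_all
      by_cases hh : l1 a = p
      · simp_all
        have := ep c hc
        tauto
      · simp_all
    · simp_all
      by_cases hh : l2 b = p
      · simp_all
        have := ep c hc
        tauto
      · simp_all
  refine ⟨M, l, step, ⟨?_, ?_⟩, ?_⟩
  · intro t c hc
    by_cases h : use1 t c
    · simp only [step, h, dite_true, l, if_true]
      exact h1.1 _ _ (act1 t c hc h)
    · simp only [step, h, dite_false, l, if_false]
      exact h2.1 _ _ (act2 t c hc h)
  · intro x c hx
    let P : ℕ → Prop := fun i => use1 (x i) (c i)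
    have A1 := mach_sub h1 (fun i => (x i).1.1) c P
    have A2 := mach_sub h2 (fun i => (x i).1.2.1) c (fun i => ¬ P i)
    have A1 := fun hp => A1 hp (fun i hi => ⟨act1 _ _ (hx i).1 hi, by
      simp only [(hx i).2, step]; rw [dif_pos hi]⟩) (fun i hi => by
      simp only [(hx i).2, step]; rw [dif_neg hi])
    have A2 := fun hp => A2 hp (fun i hi => ⟨act2 _ _ (hx i).1 hi, by
      simp only [(hx i).2, step]; rw [dif_neg hi]⟩) (fun i hi => by
      simp only [(hx i).2, step]; rw [dif_pos (not_not.1 hi)])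
    have fin : ∀ R : ℕ → Prop, ¬ (Set.ofPred R).Infinite → ∃ n, ∀ m, n ≤ m → ¬ R m := by
      intro R hR
      rw [Set.not_infinite] at hR
      obtain ⟨n, hn⟩ := hR.bddAbove
      exact ⟨n + 1, fun m hm hr => by have := hn hr; omega⟩
    by_cases i1 : (Set.ofPred P).Infinite
    · by_cases i2 : (Set.ofPred (fun i => ¬ P i)).Infinite
      · convert hU _ _ (A1 i1) (A2 i2)
        ext v
        simp only [InfOcc, Set.mem_ofPred_eq, Set.mem_union]
        constructor
        · intro h
          by_contra hcon
          push Not at hcon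
          obtain ⟨⟨n, hn⟩, ⟨k, hk⟩⟩ := hcon
          obtain ⟨j, hj, e⟩ := h (max n k)
          by_cases hP : P j
          · exact hn j (le_trans (le_max_left _ _) hj) hP e
          · exact hk j (le_trans (le_max_right _ _) hj) hP e
        · rintro (h | h) n
          · obtain ⟨k, a, b, c⟩ := h n; exact ⟨k, a, c⟩
          · obtain ⟨k, a, b, c⟩ := h n; exact ⟨k, a, c⟩
      · obtain ⟨k, hk⟩ := fin _ i2
        convert A1 i1
        ext v
        simp only [InfOcc, Set.mem_ofPred_eq]
        constructor
        · intro h n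
          obtain ⟨j, hj, e⟩ := h (max n k)
          exact ⟨j, le_trans (le_max_left _ _) hj,
            not_not.1 (hk j (le_trans (le_max_right _ _) hj)), e⟩
        · intro h n
          obtain ⟨k, a, b, c⟩ := h n; exact ⟨k, a, c⟩
    · obtain ⟨k, hk⟩ := fin _ i1
      have i2 : (Set.ofPred (fun i => ¬ P i)).Infinite := by
        by_contra i2
        obtain ⟨k', hk'⟩ := fin _ i2
        exact hk' (max k k') (le_max_right _ _) (hk _ (le_max_left _ _))
      convert A2 i2
      ext v
      simp only [InfOcc, Set.mem_ofPred_eq]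
      constructor
      · intro h n
        obtain ⟨j, hj, e⟩ := h (max n k)
        exact ⟨j, le_trans (le_max_left _ _) hj,
          (hk j (le_trans (le_max_right _ _) hj)), e⟩
      · intro h n
        obtain ⟨k, a, b, c⟩ := h n; exact ⟨k, a, c⟩
  · intro m1
    exact ⟨⟨(m1, m2, True), by simpa using hm2⟩, by simp [l]⟩

lemma mach_transfer {Lose : Set V → Prop}
    {E E1 : V × B → Finset V} {M1 : Type} {l1 : M1 → V × B}
    {s1 : M1 → V → M1} (h1 : IsMach Lose E1 l1 s1) (p : V × B)
    (e1 : ∀ q, q ≠ p → E q = E1 q) (f : V × B → V) (hf : ∀ q, f q ∈ E1 q)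
    (hw : WinF Lose f p) : IsMach Lose E l1 s1 := by
  have hne : ∀ m, l1 m ≠ p := by
    intro m hm
    let x : ℕ → M1 := fun n => Nat.rec m (fun _ y => s1 y (f (l1 y))) n
    refine hw (fun i => l1 (x i)) hm (fun i => h1.1 _ _ (hf _)) ?_
    exact h1.2 x _ (fun i => ⟨hf _, rfl⟩)
  exact ⟨fun m c hc => h1.1 m c (by rwa [← e1 _ (hne m)]), fun x c hx =>
    h1.2 x c fun i => ⟨by rw [← e1 _ (hne _)]; exact (hx i).1, (hx i).2⟩⟩

lemma infOcc_shift (c : ℕ → V) : InfOcc (fun i => c (i + 1)) = InfOcc c := by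
  ext v
  constructor
  · intro h n
    obtain ⟨k, hk, e⟩ := h n
    exact ⟨k + 1, by omega, e⟩
  · intro h n
    obtain ⟨k, hk, e⟩ := h (n + 1)
    obtain ⟨k, rfl⟩ : ∃ j, k = j + 1 := ⟨k - 1, by omega⟩
    exact ⟨k, by omega, e⟩

lemma game [Fintype V] [Fintype B] {Lose : Set V → Prop}
    (hU : ∀ S T, Lose S → Lose T → Lose (S ∪ T)) (n : ℕ) :
    ∀ (E : V × B → Finset V), (∀ p, (E p).Nonempty) → ∑ p, (E p).card = n →
    ∃ f : V × B → V, (∀ p, f p ∈ E p) ∧ ∃ (M : Type) (l : M → V × B) (step : M → V → M),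
      IsMach Lose E l step ∧ ∀ s, WinF Lose f s ∨ ∃ m, l m = s := by
  classical
  induction n using Nat.strong_induction_on with
  | _ n ih =>
  intro E hE hn
  by_cases hone : ∀ p, (E p).card ≤ 1
  · choose f hf using hE
    have huniq : ∀ p c, c ∈ E p → c = f p := fun p c hc =>
      Finset.card_le_one.1 (hone p) _ hc _ (hf p)
    refine ⟨f, hf, {b : ℕ → V × B // (∀ i, (b (i + 1)).1 = f (b i)) ∧
      Lose (InfOcc (fun i => f (b i)))}, fun b => b.1 0,
      fun b _ => ⟨fun i => b.1 (i + 1), fun i => b.2.1 (i + 1), ?_⟩, ⟨?_, ?_⟩, ?_⟩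
    · have := b.2.2
      rwa [← infOcc_shift] at this
    · intro m c hc
      rw [huniq _ _ hc]
      exact m.2.1 0
    · intro x c hx
      have hx' : ∀ i j, (x i).1 j = (x 0).1 (i + j) := by
        intro i
        induction i with
        | zero => intro j; simp
        | succ i ih =>
          intro j
          rw [(hx i).2]
          show (x i).1 (j + 1) = _
          rw [ih]
          exact congrArg _ (by omega)
      have : c = fun i => f ((x 0).1 i) := by
        funext i
        rw [huniq _ _ (hx i).1]
        exact congrArg f (hx' i 0)
      rw [this]
      exact (x 0).2.2
    · intro s
      by_cases hs : WinF Lose f s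
      · exact Or.inl hs
      · right
        simp only [WinF] at hs
        push Not at hs
        obtain ⟨b, hb, h1, h2⟩ := hs
        exact ⟨⟨b, h1, h2⟩, hb⟩
  · push Not at hone
    obtain ⟨p, hp⟩ := hone
    obtain ⟨c1, hc1⟩ := hE p
    let E1 := Function.update E p {c1}
    let E2 := Function.update E p ((E p).erase c1)
    have card2 : ((E p).erase c1).card = (E p).card - 1 := Finset.card_erase_of_mem hc1
    have lt : ∀ s : Finset V, s.card < (E p).card →
        ∑ q, (Function.update E p s q).card < n := by
      intro s hs
      rw [← hn]
      apply Finset.sum_lt_sum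
      · intro q _
        by_cases hq : q = p
        · subst hq; simp; omega
        · simp [Function.update_of_ne hq]
      · exact ⟨p, Finset.mem_univ _, by simpa using hs⟩
    have ne : ∀ s : Finset V, s.Nonempty → ∀ q, (Function.update E p s q).Nonempty := by
      intro s hs q
      by_cases hq : q = p
      · subst hq; simpa using hs
      · simpa [Function.update_of_ne hq] using hE q
    have sub : ∀ s : Finset V, s ⊆ E p → ∀ q, Function.update E p s q ⊆ E q := by
      intro s hs q
      by_cases hq : q = p
      · subst hq; simpa using hs
      · simp [Function.update_of_ne hq]
    have eqn : ∀ s : Finset V, ∀ q, q ≠ p → E q = Function.update E p s q := by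
      intro s q hq
      simp [Function.update_of_ne hq]
    obtain ⟨f1, hf1, M1, l1, s1, hM1, cov1⟩ := ih _ (lt {c1} (by simpa using hp)) E1
      (ne _ (by simp)) rfl
    obtain ⟨f2, hf2, M2, l2, s2, hM2, cov2⟩ := ih _ (lt ((E p).erase c1) (by omega)) E2
      (ne _ (by rw [← Finset.card_pos]; omega)) rfl
    have hf1' : ∀ q, f1 q ∈ E q := fun q => sub _ (by simpa using hc1) q (hf1 q)
    have hf2' : ∀ q, f2 q ∈ E q := fun q => sub _ (Finset.erase_subset _ _) q (hf2 q)
    rcases cov1 p with hw | ⟨m1, hm1⟩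
    · exact ⟨f1, hf1', M1, l1, s1, mach_transfer hM1 p (eqn _) f1 hf1 hw, cov1⟩
    rcases cov2 p with hw | ⟨m2, hm2⟩
    · exact ⟨f2, hf2', M2, l2, s2, mach_transfer hM2 p (eqn _) f2 hf2 hw, cov2⟩
    obtain ⟨M, l, step, hM, hcov⟩ := mach_combine hU hM1 hM2 p (eqn _) (eqn _) (by
      intro c hc
      by_cases h : c = c1
      · left; simp [E1, h]
      · right; simp [E2, h, hc]) m2 hm2
    refine ⟨f1, hf1', M, l, step, hM, fun s => ?_⟩
    rcases cov1 s with hw | ⟨m, hm⟩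
    · exact Or.inl hw
    · obtain ⟨m', hm'⟩ := hcov m
      exact Or.inr ⟨m', by rw [hm', hm]⟩

end Game

section Count

variable {V : Type} {m : ℕ}

/-- Player `(f, xs)` kills the thread `y` within `k` steps from `d`. -/
def Dies (f : V → Equiv.Perm (Fin m) → V) (xs : V → Equiv.Perm (Fin m) → Fin m) :
    ℕ → V → Fin m → Prop
  | 0, _, _ => False
  | k + 1, d, y => ∀ π, π y = xs d π ∨ Dies f xs k (f d π) (π y)

def GoodSt (f : V → Equiv.Perm (Fin m) → V) (xs : V → Equiv.Perm (Fin m) → Fin m)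
    (d : V) : Prop :=
  ∀ (ρ : ℕ → Equiv.Perm (Fin m)) (v : ℕ → V) (i : ℕ) (y : ℕ → Fin m), v 0 = d →
    (∀ j, v (j + 1) = f (v j) (ρ j)) →
    ¬ ∀ j, i ≤ j → y (j + 1) = ρ j (y j) ∧ y (j + 1) ≠ xs (v j) (ρ j)

variable {f : V → Equiv.Perm (Fin m) → V} {xs : V → Equiv.Perm (Fin m) → Fin m}

lemma GoodSt.next {d : V} (h : GoodSt f xs d) (π : Equiv.Perm (Fin m)) :
    GoodSt f xs (f d π) := by
  intro ρ v i y hv hstep hy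
  refine h (fun n => Nat.casesOn n π ρ) (fun n => Nat.casesOn n d v) (i + 1)
    (fun n => Nat.casesOn n (y 0) y) rfl ?_ ?_
  · intro j
    cases j with
    | zero => exact hv
    | succ j => exact hstep j
  · intro j hj
    cases j with
    | zero => omega
    | succ j => exact hy j (by omega)

lemma Dies.mono {k k' : ℕ} (hk : k ≤ k') : ∀ {d y}, Dies f xs k d y → Dies f xs k' d y := by
  induction k generalizing k' with
  | zero => intro d y h; exact h.elim
  | succ k ih =>
    intro d y h
    obtain ⟨k', rfl⟩ : ∃ j, k' = j + 1 := ⟨k' - 1, by omega⟩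
    intro π
    exact (h π).imp id (ih (by omega))

lemma exists_dies {d : V} (h : GoodSt f xs d) (y : Fin m) : ∃ k, Dies f xs k d y := by
  by_contra hcon
  push Not at hcon
  have step : ∀ t : {t : V × Fin m // ∀ k, ¬ Dies f xs k t.1 t.2},
      ∃ π : Equiv.Perm (Fin m), π t.1.2 ≠ xs t.1.1 π ∧
        ∀ k, ¬ Dies f xs k (f t.1.1 π) (π t.1.2) := by
    rintro ⟨⟨d, y⟩, ht⟩
    by_contra hc
    push Not at hc
    have : ∀ π : Equiv.Perm (Fin m), ∃ k, π y = xs d π ∨ Dies f xs k (f d π) (π y) := by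
      intro π
      by_cases e : π y = xs d π
      · exact ⟨0, Or.inl e⟩
      · obtain ⟨k, hk⟩ := hc π e
        exact ⟨k, Or.inr hk⟩
    choose K hK using this
    refine ht (Finset.univ.sup K + 1) fun π => (hK π).imp id (Dies.mono ?_)
    exact Finset.le_sup (f := K) (Finset.mem_univ π)
  choose π h1 h2 using step
  let x : ℕ → {t : V × Fin m // ∀ k, ¬ Dies f xs k t.1 t.2} := fun n =>
    Nat.rec ⟨(d, y), hcon⟩ (fun _ t => ⟨(f t.1.1 (π t), π t t.1.2), h2 t⟩) n
  exact h (fun n => π (x n)) (fun n => (x n).1.1) 0 (fun n => (x n).1.2) rfl (fun j => rfl)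
    fun j _ => ⟨rfl, h1 (x j)⟩

lemma count_bound [Fintype V] {d0 : V} (h0 : GoodSt f xs d0) {s : ℕ} (hs : 1 ≤ s) (hsm : s ≤ m) :
    m.choose s ≤ Fintype.card V * m := by
  classical
  let U : ℕ → V → Finset (Fin m) := fun k d => Finset.univ.filter fun y => Dies f xs k d y
  have hex : ∃ k, ∃ d, GoodSt f xs d ∧ s ≤ (U k d).card := by
    choose K hK using exists_dies h0
    refine ⟨Finset.univ.sup K, d0, h0, ?_⟩
    have : U (Finset.univ.sup K) d0 = Finset.univ := by
      apply Finset.filter_true_of_mem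
      intro y _
      exact Dies.mono (Finset.le_sup (f := K) (Finset.mem_univ y)) (hK y)
    rw [this]; simpa using hsm
  obtain ⟨d, hd, hcard⟩ := Nat.find_spec hex
  have hmin := fun k => @Nat.find_min _ _ hex k
  generalize Nat.find hex = k at *
  cases k with
  | zero =>
    have : U 0 d = ∅ := by
      apply Finset.filter_false_of_mem
      intro y _ h
      exact h
    rw [this] at hcard
    simp at hcard
    omega
  | succ k =>
    have small : ∀ π, (U k (f d π)).card < s := by
      intro π
      by_contra hc
      exact hmin k (Nat.lt_succ_self k) ⟨_, hd.next π, by omega⟩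
    have subs : ∀ π : Equiv.Perm (Fin m),
        ((U (k + 1) d).map π.toEmbedding).erase (xs d π) ⊆ U k (f d π) := by
      intro π z hz
      rw [Finset.mem_erase, Finset.mem_map] at hz
      obtain ⟨hz1, y, hy, rfl⟩ := hz
      simp only [U, Finset.mem_filter, Finset.mem_univ, true_and] at hy ⊢
      exact (hy π).resolve_left hz1
    have ce : ∀ π : Equiv.Perm (Fin m), (U (k + 1) d).card - 1 ≤
        (((U (k + 1) d).map π.toEmbedding).erase (xs d π)).card := by
      intro π
      have := Finset.pred_card_le_card_erase (s := (U (k + 1) d).map π.toEmbedding) (a := xs d π)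
      simpa using this
    have hs' : (U (k + 1) d).card = s := by
      have := (ce 1).trans (Finset.card_le_card (subs 1))
      have := small 1
      omega
    have eqU : ∀ π : Equiv.Perm (Fin m), U k (f d π) ⊆ (U (k + 1) d).map π.toEmbedding ∧
        (U k (f d π)).card + 1 = s := by
      intro π
      have e := Finset.eq_of_subset_of_card_le (subs π) (by
        have := ce π; have := small π; omega)
      refine ⟨by rw [← e]; exact Finset.erase_subset _ _, ?_⟩
      have := (ce π).trans (Finset.card_le_card (subs π))
      have := small π
      omega
    have hall : ∀ T ∈ Finset.powersetCard s (Finset.univ : Finset (Fin m)),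
        ∃ q : V × Fin m, insert q.2 (U k q.1) = T := by
      intro T hT
      rw [Finset.mem_powersetCard] at hT
      have : ∃ π : Equiv.Perm (Fin m), (U (k + 1) d).map π.toEmbedding = T := by
        let e := Finset.equivOfCardEq (s := U (k + 1) d) (t := T) (by rw [hs', hT.2])
        refine ⟨e.extendSubtype, Finset.eq_of_subset_of_card_le ?_ ?_⟩
        · intro z hz
          rw [Finset.mem_map] at hz
          obtain ⟨y, hy, rfl⟩ := hz
          exact e.extendSubtype_mem y hy
        · rw [Finset.card_map, hs', hT.2]
      obtain ⟨π, rfl⟩ := this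
      obtain ⟨a, b⟩ := eqU π
      have : ((U (k + 1) d).map π.toEmbedding \ U k (f d π)).card = 1 := by
        rw [Finset.card_sdiff_of_subset a, Finset.card_map]; omega
      obtain ⟨z, hz⟩ := Finset.card_eq_one.1 this
      refine ⟨(f d π, z), ?_⟩
      rw [← Finset.sdiff_union_of_subset a, hz]
      rfl
    have hsub : Finset.powersetCard s (Finset.univ : Finset (Fin m)) ⊆
        Finset.univ.image fun q : V × Fin m => insert q.2 (U k q.1) := by
      intro T hT
      obtain ⟨q, hq⟩ := hall T hT
      exact Finset.mem_image.2 ⟨q, Finset.mem_univ _, hq⟩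
    have := (Finset.card_le_card hsub).trans Finset.card_image_le
    simpa using this

end Count

section Family

variable {m : ℕ}

abbrev Ltr (m : ℕ) : Type := Equiv.Perm (Fin m) × Fin m

/-- The co-Büchi automaton of the family. -/
def famAuto (m : ℕ) : Auto (Ltr m) (Option (Fin m)) where
  init := Set.univ
  next q a := {t | match q with
    | none => t ≠ none
    | some y => t = if a.1 y = a.2 then none else some (a.1 y)}

lemma prefixWord_succ {A : Type} (w : ℕ → A) (n : ℕ) :
    prefixWord w (n + 1) = prefixWord w n ++ [w n] := by
  simp [prefixWord, List.range_succ]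

lemma prefixWord_zero {A : Type} (w : ℕ → A) : prefixWord w 0 = [] := rfl

def permOf (u : List (Ltr m)) : Equiv.Perm (Fin m) := u.foldl (fun P a => a.1 * P) 1

def PP (w : ℕ → Ltr m) (n : ℕ) : Equiv.Perm (Fin m) := permOf (prefixWord w n)

lemma PP_succ (w : ℕ → Ltr m) (n : ℕ) : PP w (n + 1) = (w n).1 * PP w n := by
  simp [PP, permOf, prefixWord_succ]

def Survive (w : ℕ → Ltr m) : Prop :=
  ∃ z i, ∀ j, i ≤ j → PP w (j + 1) z ≠ (w j).2

def famT (m : ℕ) [NeZero m] : Transducer (Ltr m) (Option (Fin m))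
    (Equiv.Perm (Fin m) × ℕ × Bool) where
  m0 := (1, 0, true)
  upd s a := (a.1 * s.1, if s.2.2 then (s.2.1 + 1, false)
    else (s.2.1, decide (a.1 (s.1 (Fin.ofNat m s.2.1)) = a.2)))
  out s := if s.2.2 then none else some (s.1 (Fin.ofNat m s.2.1))

def famMem [NeZero m] (w : ℕ → Ltr m) (n : ℕ) : Equiv.Perm (Fin m) × ℕ × Bool :=
  (famT m).run (famT m).m0 (prefixWord w n)

lemma famMem_succ [NeZero m] (w : ℕ → Ltr m) (n : ℕ) :
    famMem w (n + 1) = (famT m).upd (famMem w n) (w n) := by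
  simp [famMem, Transducer.run, prefixWord_succ]

lemma famMem_one [NeZero m] (w : ℕ → Ltr m) (n : ℕ) : (famMem w n).1 = PP w n := by
  induction n with
  | zero => rfl
  | succ n ih => rw [famMem_succ, PP_succ, ← ih]; rfl

lemma famRun [NeZero m] (w : ℕ → Ltr m) :
    (famAuto m).IsRun w (StrategyRun (famT m).strategy w) := by
  refine ⟨Set.mem_univ _, fun i => ?_⟩
  change (famT m).out (famMem w (i + 1)) ∈ (famAuto m).next ((famT m).out (famMem w i)) (w i)
  rw [famMem_succ]
  obtain ⟨P, c, b⟩ := famMem w i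
  cases b
  · simp [famAuto, famT]
  · simp [famAuto, famT]

lemma fam_surv_acc [NeZero m] (w : ℕ → Ltr m) (h : Survive w) :
    CoBuchiAcc {none} (InfOcc (StrategyRun (famT m).strategy w)) := by
  obtain ⟨z, i, hz⟩ := h
  unfold CoBuchiAcc
  rw [Set.inter_singleton_eq_empty]
  intro hinf
  have hdead : ∀ n, ∃ j, n ≤ j ∧ (famMem w j).2.2 = true := by
    intro n
    obtain ⟨j, hj, e⟩ := hinf n
    refine ⟨j, hj, ?_⟩
    change (famT m).out (famMem w j) = none at e
    by_contra hb
    simp [famT, hb] at e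
  have adv : ∀ d j, (famMem w (j + d)).2.2 = true →
      ∃ j', j < j' ∧ (famMem w j').2.1 = (famMem w j).2.1 + 1 ∧ (famMem w j').2.2 = false := by
    intro d
    induction d with
    | zero =>
      intro j hj
      refine ⟨j + 1, by omega, ?_⟩
      rw [famMem_succ]
      simp only [add_zero] at hj
      simp [famT, hj]
    | succ d ih =>
      intro j hj
      by_cases hb : (famMem w j).2.2 = true
      · refine ⟨j + 1, by omega, ?_⟩
        rw [famMem_succ]
        simp [famT, hb]
      · obtain ⟨j', h1, h2, h3⟩ := ih (j + 1) (by rw [← hj, show j + 1 + d = j + (d + 1) by omega])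
        refine ⟨j', by omega, ?_, h3⟩
        rw [h2, famMem_succ]
        simp [famT, hb]
  have adv' : ∀ j, ∃ j', j < j' ∧ (famMem w j').2.1 = (famMem w j).2.1 + 1 ∧
      (famMem w j').2.2 = false := by
    intro j
    obtain ⟨k, hk, e⟩ := hdead j
    exact adv (k - j) j (by rw [Nat.add_sub_cancel' hk]; exact e)
  have advs : ∀ t, ∃ j, i ≤ j ∧ (famMem w j).2.1 = (famMem w i).2.1 + 1 + t ∧
      (famMem w j).2.2 = false := by
    intro t
    induction t with
    | zero =>
      obtain ⟨j, a, b, c⟩ := adv' i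
      exact ⟨j, by omega, b, c⟩
    | succ t ih =>
      obtain ⟨j, a, b, c⟩ := ih
      obtain ⟨j', a', b', c'⟩ := adv' j
      exact ⟨j', by omega, by omega, c'⟩
  have hmpos : 0 < m := Nat.pos_of_ne_zero (NeZero.ne m)
  have : ∃ t, Fin.ofNat m ((famMem w i).2.1 + 1 + t) = z := by
    set K := (famMem w i).2.1 + 1 with hK
    refine ⟨z.1 + m * K - K, ?_⟩
    have : K ≤ m * K := Nat.le_mul_of_pos_left _ hmpos
    have e : K + (z.1 + m * K - K) = z.1 + m * K := by omega
    rw [e]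
    apply Fin.ext
    simp [Fin.ofNat, Nat.mod_eq_of_lt z.2]
  obtain ⟨t, ht⟩ := this
  obtain ⟨j, hj, hc, hb⟩ := advs t
  have stay : ∀ d, Fin.ofNat m (famMem w (j + d)).2.1 = z ∧ (famMem w (j + d)).2.2 = false := by
    intro d
    induction d with
    | zero => exact ⟨by rw [add_zero, hc, ht], hb⟩
    | succ d ih =>
      have hk := hz (j + d) (by omega)
      rw [PP_succ, ← famMem_one] at hk
      rw [← add_assoc, famMem_succ]
      obtain ⟨a, b⟩ := ih
      constructor
      · simp [famT, b]; exact a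
      · simp only [famT, b, a]
        simpa using hk
  obtain ⟨k, hk, e⟩ := hdead j
  have := (stay (k - j)).2
  rw [Nat.add_sub_cancel' hk, e] at this
  simp at this

lemma fam_acc_surv (w : ℕ → Ltr m) (h : w ∈ (famAuto m).Lang (CoBuchiAcc {none})) :
    Survive w := by
  obtain ⟨r, ⟨-, hr⟩, hacc⟩ := h
  unfold CoBuchiAcc at hacc
  rw [Set.inter_singleton_eq_empty] at hacc
  have : ∃ i, ∀ j, i ≤ j → r j ≠ none := by
    by_contra hc
    push Not at hc
    exact hacc hc
  obtain ⟨i, hi⟩ := this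
  obtain ⟨y, hy⟩ := Option.ne_none_iff_exists'.1 (hi i le_rfl)
  have key : ∀ d, r (i + d) = some (PP w (i + d) ((PP w i)⁻¹ y)) := by
    intro d
    induction d with
    | zero => simp [hy]
    | succ d ih =>
      have h1 := hr (i + d)
      have h2 := hi (i + d + 1) (by omega)
      rw [ih] at h1
      simp only [famAuto, Set.mem_ofPred_eq] at h1
      rw [← add_assoc, h1, PP_succ]
      rw [h1] at h2
      split_ifs at h2 ⊢ with hh
      · exact absurd rfl h2
      · rfl
  refine ⟨(PP w i)⁻¹ y, i, fun j hj hk => ?_⟩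
  obtain ⟨d, rfl⟩ : ∃ d, j = i + d := ⟨j - i, by omega⟩
  have h1 := hr (i + d)
  have h2 := hi (i + d + 1) (by omega)
  rw [key] at h1
  simp only [famAuto, Set.mem_ofPred_eq] at h1
  rw [PP_succ] at hk
  rw [Equiv.Perm.mul_apply] at hk
  rw [if_pos hk] at h1
  exact h2 h1

lemma fam_lang [NeZero m] (w : ℕ → Ltr m) :
    w ∈ (famAuto m).Lang (CoBuchiAcc {none}) ↔ Survive w :=
  ⟨fam_acc_surv w, fun h => ⟨_, famRun w, fam_surv_acc w h⟩⟩

lemma fam_gfg [NeZero m] : IsGFG (famAuto m) (CoBuchiAcc {none}) :=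
  ⟨(famT m).strategy, fun w => ⟨famRun w, fun h => fam_surv_acc w (fam_acc_surv w h)⟩⟩

end Family

section Main

variable {m : ℕ}

lemma strat_step {A Q : Type} {M : Auto A Q} {acc : Set Q → Prop} {g : List A → Q}
    (hg : IsGFGStrategy M acc g) (u : List A) (a : A) :
    g (u ++ [a]) ∈ M.next (g u) a := by
  let w : ℕ → A := fun i => (u ++ [a]).getD i a
  have hp : ∀ n, n ≤ u.length → prefixWord w n = u.take n := by
    intro n hn
    induction n with
    | zero => simp [prefixWord_zero]
    | succ n ih =>
      have hlt : n < u.length := by omega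
      rw [prefixWord_succ, ih (by omega), List.take_succ_eq_append_getElem hlt]
      congr 2
      simp [w, List.getElem?_append_left hlt, hlt]
  have h1 : prefixWord w u.length = u := by rw [hp _ le_rfl, List.take_length]
  have h3 : w u.length = a := by simp [w]
  have h2 : prefixWord w (u.length + 1) = u ++ [a] := by
    rw [prefixWord_succ, h1, h3]
  have := (hg w).1.2 u.length
  simp only [StrategyRun, h1, h2, h3] at this
  exact this

lemma strat_init {A Q : Type} [Nonempty A] {M : Auto A Q} {acc : Set Q → Prop} {g : List A → Q}
    (hg : IsGFGStrategy M acc g) : g [] ∈ M.init :=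
  (hg (fun _ => Classical.arbitrary A)).1.1

lemma infOcc_val {Q : Type} {P : Q → Prop} (c : ℕ → {q // P q}) :
    Subtype.val '' (InfOcc c) = InfOcc (fun i => (c i).1) := by
  ext q
  constructor
  · rintro ⟨v, hv, rfl⟩ n
    obtain ⟨k, hk, e⟩ := hv n
    exact ⟨k, hk, by simp [e]⟩
  · intro h
    obtain ⟨k, -, e⟩ := h 0
    refine ⟨c k, fun n => ?_, e⟩
    obtain ⟨j, hj, e'⟩ := h n
    exact ⟨j, hj, Subtype.ext (e'.trans e.symm)⟩

lemma rabin_union {Q ι : Type} {E F : ι → Set Q} {S T : Set Q}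
    (hS : ¬ RabinAcc E F S) (hT : ¬ RabinAcc E F T) : ¬ RabinAcc E F (S ∪ T) := by
  rintro ⟨i, h1, h2⟩
  rw [Set.union_inter_distrib_right, Set.union_empty_iff] at h1
  rw [Set.union_inter_distrib_right, Set.union_nonempty] at h2
  rcases h2 with h | h
  · exact hS ⟨i, h1.1, h⟩
  · exact hT ⟨i, h1.2, h⟩

lemma killer_not_survive [NeZero m] (w : ℕ → Ltr m)
    (h : ∀ j, (w j).2 = (w j).1 (PP w j (Fin.ofNat m j))) : ¬ Survive w := by
  rintro ⟨z, i, hz⟩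
  have hmpos : 0 < m := Nat.pos_of_ne_zero (NeZero.ne m)
  have hle : i ≤ z.1 + m * i := le_trans (Nat.le_mul_of_pos_left _ hmpos) (Nat.le_add_left _ _)
  apply hz _ hle
  rw [h, PP_succ, Equiv.Perm.mul_apply]
  congr 2
  apply Fin.ext
  simp [Fin.ofNat, Nat.mod_eq_of_lt z.2]

lemma exists_good [NeZero m] {Q ι : Type} [Fintype Q] (R : Auto (Ltr m) Q) (E F : ι → Set Q)
    (hR : IsGFG R (RabinAcc E F))
    (hL : ∀ w, w ∈ R.Lang (RabinAcc E F) ↔ ¬ Survive w) :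
    ∃ (P : Q → Prop) (f : {q // P q} → Equiv.Perm (Fin m) → {q // P q})
      (xs : {q // P q} → Equiv.Perm (Fin m) → Fin m) (d : {q // P q}), GoodSt f xs d := by
  classical
  obtain ⟨g, hg⟩ := hR
  let P : Q → Prop := fun q => ∃ u, g u = q
  let V := {q // P q}
  let gV : List (Ltr m) → V := fun u => ⟨g u, u, rfl⟩
  let Lose : Set V → Prop := fun S => ¬ RabinAcc E F (Subtype.val '' S)
  have hU : ∀ S T, Lose S → Lose T → Lose (S ∪ T) := by
    intro S T hS hT
    simp only [Lose, Set.image_union] at *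
    exact rabin_union hS hT
  let G : V × Equiv.Perm (Fin m) → Finset V := fun p =>
    Finset.univ.filter fun q => ∃ x, q.1 ∈ R.next p.1.1 (p.2, x)
  have hG : ∀ p, (G p).Nonempty := by
    rintro ⟨⟨q, u, rfl⟩, π⟩
    refine ⟨gV (u ++ [(π, 0)]), ?_⟩
    simp only [G, Finset.mem_filter, Finset.mem_univ, true_and]
    exact ⟨0, strat_step hg u _⟩
  obtain ⟨f, hf, M, l, step, hM, cov⟩ := game hU _ G hG rfl
  have win : ∀ π, WinF Lose f (gV [], π) := by
    intro π0
    rcases cov (gV [], π0) with h | ⟨m0, hm0⟩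
    · exact h
    exfalso
    let ltr : M × List (Ltr m) → Ltr m := fun t =>
      ((l t.1).2, (l t.1).2 (permOf t.2 (Fin.ofNat m t.2.length)))
    let Z : ℕ → M × List (Ltr m) := fun n => Nat.rec (m0, [])
      (fun _ t => (step t.1 (gV (t.2 ++ [ltr t])), t.2 ++ [ltr t])) n
    let w : ℕ → Ltr m := fun i => ltr (Z i)
    have hZ : ∀ n, (Z n).2 = prefixWord w n := by
      intro n
      induction n with
      | zero => rfl
      | succ n ih => rw [prefixWord_succ, ← ih]
    have hmem : ∀ n, (l (Z n).1).1 = gV (Z n).2 →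
        gV ((Z n).2 ++ [ltr (Z n)]) ∈ G (l (Z n).1) := by
      intro n hn
      simp only [G, Finset.mem_filter, Finset.mem_univ, true_and]
      rw [hn]
      exact ⟨_, strat_step hg (Z n).2 (ltr (Z n))⟩
    have hinv : ∀ n, (l (Z n).1).1 = gV (Z n).2 := by
      intro n
      induction n with
      | zero => exact congrArg Prod.fst hm0
      | succ n ih => exact hM.1 _ _ (hmem n ih)
    have hlose := hM.2 (fun n => (Z n).1) (fun n => gV ((Z n).2 ++ [ltr (Z n)]))
      (fun n => ⟨hmem n (hinv n), rfl⟩)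
    have hns : ¬ Survive w := by
      apply killer_not_survive
      intro j
      have hlen : (prefixWord w j).length = j := by simp [prefixWord]
      simp only [w, ltr, PP]
      rw [hZ j, hlen]
    apply hlose
    rw [infOcc_val]
    have := (hg w).2 ((hL w).2 hns)
    rw [← infOcc_shift] at this
    convert this using 3 with n
    simp only [StrategyRun, gV, prefixWord_succ, hZ]
    rfl
  have hxs : ∀ p, ∃ x, (f p).1 ∈ R.next p.1.1 (p.2, x) := by
    intro p
    have := hf p
    simpa only [G, Finset.mem_filter, Finset.mem_univ, true_and] using this
  choose xs hxs using hxs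
  refine ⟨P, fun q π => f (q, π), fun q π => xs (q, π), gV [], ?_⟩
  intro ρ v i y hv hstep hy
  have hacc := win (ρ 0) (fun j => (v j, ρ j)) (by simp [hv]) hstep
  simp only [Lose, not_not] at hacc
  rw [infOcc_val] at hacc
  have hacc' : RabinAcc E F (InfOcc (fun j => (v j).1)) := by
    rw [← infOcc_shift]
    convert hacc using 4 with j
    exact hstep j
  let w : ℕ → Ltr m := fun j => (ρ j, xs (v j, ρ j))
  have hw : w ∈ R.Lang (RabinAcc E F) := by
    refine ⟨_, ⟨?_, ?_⟩, hacc'⟩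
    · rw [hv]; exact strat_init hg
    · intro j
      rw [hstep]
      exact hxs (v j, ρ j)
  refine (hL w).1 hw ⟨(PP w i)⁻¹ (y i), i, fun j hj => ?_⟩
  have hpp : ∀ d, PP w (i + d) ((PP w i)⁻¹ (y i)) = y (i + d) := by
    intro d
    induction d with
    | zero => simp
    | succ d ih =>
      rw [← add_assoc, PP_succ, Equiv.Perm.mul_apply, ih, (hy (i + d) (by omega)).1]
  have := hpp (j + 1 - i)
  rw [Nat.add_sub_cancel' (by omega)] at this
  rw [this]
  exact (hy j hj).2

lemma four_sq_le (s : ℕ) (hs : 8 ≤ s) : 4 * s * s ≤ 2 ^ s := by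
  induction s, hs using Nat.le_induction with
  | base => norm_num
  | succ s hs ih => rw [pow_succ]; nlinarith

end Main

/-- Complementing GFG co-Büchi automata into GFG Rabin automata
involves an exponential state blow-up. -/
theorem stmt19 :
    ∃ c : ℝ, 0 < c ∧ ∀ N : ℕ, ∃ n : ℕ, N ≤ n ∧
      ∃ (A Q : Type) (instA : Fintype A) (instQ : Fintype Q)
        (C : Auto A Q) (α : Set Q),
        @Fintype.card Q instQ ≤ n ∧ IsGFG C (CoBuchiAcc α) ∧
        ∀ (Q' : Type) [Fintype Q'] (R : Auto A Q') (ι : Type) [Fintype ι]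
          (E F : ι → Set Q'),
          IsGFG R (RabinAcc E F) →
          R.Lang (RabinAcc E F) = (C.Lang (CoBuchiAcc α))ᶜ →
          (2 : ℝ) ^ (c * n) ≤ (Fintype.card Q' : ℝ) := by
  refine ⟨1 / 4, by norm_num, fun N => ?_⟩
  obtain ⟨s, hs, hN⟩ : ∃ s : ℕ, 8 ≤ s ∧ N ≤ s := ⟨N + 8, by omega, by omega⟩
  have : NeZero (2 * s) := ⟨by omega⟩
  refine ⟨2 * s + 1, by omega, Ltr (2 * s), Option (Fin (2 * s)), inferInstance, inferInstance,
    famAuto (2 * s), {none}, by simp, fam_gfg, ?_⟩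
  intro Q' _ R ι _ E F hR hL
  classical
  obtain ⟨P, f, xs, d, hd⟩ := exists_good R E F hR (fun w => by
    rw [hL, Set.mem_compl_iff, fam_lang])
  have hb := count_bound hd (s := s) (by omega) (by omega)
  have h1 := Nat.four_pow_le_two_mul_self_mul_centralBinom s (by omega)
  rw [Nat.centralBinom_eq_two_mul_choose] at h1
  have hP : Fintype.card {q // P q} ≤ Fintype.card Q' := Fintype.card_subtype_le P
  have h2 : 2 ^ s * 2 ^ s ≤ 2 ^ s * Fintype.card Q' := by
    calc 2 ^ s * 2 ^ s = 4 ^ s := by rw [← mul_pow]; norm_num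
      _ ≤ 2 * s * (2 * s).choose s := h1
      _ ≤ 2 * s * (Fintype.card Q' * (2 * s)) :=
        Nat.mul_le_mul_left _ (hb.trans (Nat.mul_le_mul_right _ hP))
      _ = 4 * s * s * Fintype.card Q' := by ring
      _ ≤ 2 ^ s * Fintype.card Q' := Nat.mul_le_mul_right _ (four_sq_le s hs)
  have h3 : 2 ^ s ≤ Fintype.card Q' := Nat.le_of_mul_le_mul_left h2 (by positivity)
  calc (2 : ℝ) ^ ((1 / 4 : ℝ) * ((2 * s + 1 : ℕ) : ℝ)) ≤ (2 : ℝ) ^ (s : ℝ) := by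
        apply Real.rpow_le_rpow_of_exponent_le (by norm_num)
        have : (8 : ℝ) ≤ s := by exact_mod_cast hs
        push_cast
        linarith
    _ = ((2 ^ s : ℕ) : ℝ) := by rw [Real.rpow_natCast]; push_cast; rfl
    _ ≤ _ := by exact_mod_cast h3

end GFG
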